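/- Let a(n) denote the number of permutations of length n (with a(0) = 1 for the empty permutation) lying in the juxtaposition class Av(312|21), i.e. permutations σ of length n for which the positions can be split at some cut point k (0 ≤ k ≤ n) so that σ has no occurrence of the pattern 312 using only positions ≤ k and no occurrence of the pattern 21 using only positions > k. Then there exist formal power series c(z), d(z), b(z), m(z) in ℚ[[z]] satisfying the system c = 1 + z·c², (1−z)·d = (1−z) + z·d², (1−z)·b = (1−z)·z·c·b + z², and (1−z)·m = z²·(d−1) + (1−z)·z·c·b·(d−1) + (1−z)·z·c·m·d, such that the generating function F(z) = Σ_{n≥0} a(n) z^n satisfies F = c + c·m·d. -/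

import Mathlib

/-- `σ` contains an occurrence of the pattern `π` using only positions in `S`. -/
def ContainsIn {n m : ℕ} (σ : Equiv.Perm (Fin n)) (π : Equiv.Perm (Fin m))
    (S : Set (Fin n)) : Prop :=
  ∃ f : Fin m → Fin n, StrictMono f ∧ (∀ s, f s ∈ S) ∧
    ∀ s t : Fin m, σ (f s) < σ (f t) ↔ π s < π t

/-- `σ` contains an occurrence of the pattern `π`. -/
def Contains {n m : ℕ} (σ : Equiv.Perm (Fin n)) (π : Equiv.Perm (Fin m)) : Prop :=
  ContainsIn σ π Set.univ

/-- `σ` avoids the pattern `π`. -/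
def Avoids {n m : ℕ} (σ : Equiv.Perm (Fin n)) (π : Equiv.Perm (Fin m)) : Prop :=
  ¬ Contains σ π

/-- `σ` lies in the juxtaposition class `Av(P|Q)`: positions split at some cut `k`
(`0 ≤ k ≤ n`), no occurrence of `P` within the first `k` positions and no occurrence
of `Q` within the remaining positions. -/
def JuxtAv {n p q : ℕ} (P : Equiv.Perm (Fin p)) (Q : Equiv.Perm (Fin q))
    (σ : Equiv.Perm (Fin n)) : Prop :=
  ∃ k ≤ n, ¬ ContainsIn σ P {i : Fin n | (i : ℕ) < k} ∧
    ¬ ContainsIn σ Q {i : Fin n | k ≤ (i : ℕ)}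

noncomputable def p312 : Equiv.Perm (Fin 3) :=
  Equiv.ofBijective (![2,0,1] : Fin 3 → Fin 3) (by decide)

noncomputable def p21 : Equiv.Perm (Fin 2) :=
  Equiv.ofBijective (![1,0] : Fin 2 → Fin 2) (by decide)

noncomputable def F : PowerSeries ℚ :=
  PowerSeries.mk fun n => (Nat.card {σ : Equiv.Perm (Fin n) // JuxtAv p312 p21 σ} : ℚ)

open Finset

/-- list avoidance of 312 -/
def LAv : List ℕ → Prop
  | [] => True
  | a :: l => l.Pairwise (fun b c => ¬ (b < c ∧ c < a)) ∧ LAv l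

/-- `l` lists the elements of `S` -/
def Lst (S : Finset ℕ) (l : List ℕ) : Prop := l.Nodup ∧ ∀ x, x ∈ l ↔ x ∈ S

theorem pairwise_of_mem {R : ℕ → ℕ → Prop} {l : List ℕ} (h : ∀ x ∈ l, ∀ y ∈ l, R x y) :
    l.Pairwise R := by
  induction l with
  | nil => simp
  | cons a l ih =>
    rw [List.pairwise_cons]
    exact ⟨fun x hx => h a (by simp) x (by simp [hx]),
      ih fun x hx y hy => h x (by simp [hx]) y (by simp [hy])⟩

theorem LAv_append_single (l : List ℕ) (v : ℕ) :
    LAv (l ++ [v]) ↔ LAv l ∧ l.Pairwise (fun a b => ¬ (b < v ∧ v < a)) := by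
  induction l with
  | nil => simp [LAv]
  | cons a l ih =>
    simp only [List.cons_append, LAv, ih, List.pairwise_append, List.pairwise_cons]
    simp
    tauto

theorem LAv_append_left (l l' : List ℕ) (h : LAv (l ++ l')) : LAv l := by
  induction l with
  | nil => simp [LAv]
  | cons a l ih =>
    simp only [List.cons_append, LAv, List.pairwise_append] at h ⊢
    exact ⟨h.1.1, ih h.2⟩

theorem LAv_append_lt (l l' : List ℕ) (h : ∀ a ∈ l, ∀ b ∈ l', a < b) :
    LAv (l ++ l') ↔ LAv l ∧ LAv l' := by
  induction l with
  | nil => simp [LAv]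
  | cons a l ih =>
    have ih := ih (fun x hx => h x (by simp [hx]))
    simp only [List.cons_append, LAv, List.pairwise_append, ih]
    have h1 : l'.Pairwise (fun b c => ¬ (b < c ∧ c < a)) := by
      apply pairwise_of_mem
      intro x hx y hy hh
      have := h a (by simp) y hy
      omega
    have h2 : ∀ x ∈ l, ∀ y ∈ l', ¬ (x < y ∧ y < a) := by
      intro x hx y hy hh
      have := h a (by simp) y hy
      omega
    tauto

theorem split_of_pairwise (l : List ℕ) (v : ℕ) (hv : v ∉ l)
    (h : l.Pairwise (fun a b => ¬ (b < v ∧ v < a))) :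
    l = l.filter (· < v) ++ l.filter (v < ·) := by
  induction l with
  | nil => simp
  | cons a l ih =>
    simp only [List.mem_cons, not_or] at hv
    rw [List.pairwise_cons] at h
    have ih := ih hv.2 h.2
    rcases lt_or_gt_of_ne hv.1 with h1 | h1
    · have h2 : l.filter (· < v) = [] := by
        rw [List.filter_eq_nil_iff]
        intro x hx
        have := h.1 x hx
        simp; omega
      rw [h2] at ih
      simp only [List.nil_append] at ih
      rw [List.filter_cons_of_neg (by simp; omega), List.filter_cons_of_pos (by simp; omega), h2, ← ih]
      simp
    · rw [List.filter_cons_of_pos (by simp; omega), List.filter_cons_of_neg (by simp; omega)]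
      rw [List.cons_append, ← ih]

theorem LAv_split (l : List ℕ) (v : ℕ) (hv : v ∉ l) (h : LAv (l ++ [v])) :
    l = l.filter (· < v) ++ l.filter (v < ·) ∧ LAv (l.filter (· < v)) ∧ LAv (l.filter (v < ·)) := by
  rw [LAv_append_single] at h
  have h1 := split_of_pairwise l v hv h.2
  refine ⟨h1, ?_⟩
  have h2 := h.1
  rw [h1, LAv_append_lt] at h2
  · exact h2
  · simp only [List.mem_filter, decide_eq_true_eq]
    intro a ha b hb
    omega

theorem LAv_join (l l' : List ℕ) (v : ℕ) (h1 : ∀ x ∈ l, x < v) (h2 : ∀ x ∈ l', v < x)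
    (h3 : LAv l) (h4 : LAv l') : LAv (l ++ l' ++ [v]) := by
  rw [LAv_append_single, LAv_append_lt _ _ (fun a ha b hb => (h1 a ha).trans (h2 b hb))]
  refine ⟨⟨h3, h4⟩, ?_⟩
  rw [List.pairwise_append]
  refine ⟨?_, ?_, ?_⟩
  · apply pairwise_of_mem
    intro x hx y hy hh
    have := h1 x hx
    omega
  · apply pairwise_of_mem
    intro x hx y hy hh
    have := h2 y hy
    omega
  · intro x hx y hy hh
    have := h1 x hx
    omega

theorem filter_lt_append (l l' : List ℕ) (v : ℕ) (h1 : ∀ x ∈ l, x < v) (h2 : ∀ x ∈ l', v < x) :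
    (l ++ l').filter (· < v) = l ∧ (l ++ l').filter (v < ·) = l' := by
  constructor
  · rw [List.filter_append, List.filter_eq_self.2 (by simpa using h1), List.filter_eq_nil_iff.2]
    · simp
    · intro x hx; have := h2 x hx; simp; omega
  · rw [List.filter_append, List.filter_eq_self (l := l').2 (by simpa using h2),
      List.filter_eq_nil_iff.2]
    · simp
    · intro x hx; have := h1 x hx; simp; omega

theorem Lst.length {S : Finset ℕ} {l : List ℕ} (h : Lst S l) : l.length = #S := by
  rw [← List.toFinset_card_of_nodup h.1]
  congr 1
  ext x; simp [h.2]

/-- all nodup lists with elements in `S` -/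
noncomputable def LL (S : Finset ℕ) : Finset (List ℕ) :=
  S.powerset.biUnion fun T => T.toList.permutations.toFinset

theorem mem_LL {S : Finset ℕ} {l : List ℕ} : l ∈ LL S ↔ l.Nodup ∧ ∀ x ∈ l, x ∈ S := by
  simp only [LL, mem_biUnion, mem_powerset, List.mem_toFinset, List.mem_permutations]
  constructor
  · rintro ⟨T, hT, hl⟩
    refine ⟨hl.nodup_iff.2 (nodup_toList T), fun x hx => hT ?_⟩
    simpa using hl.mem_iff.1 hx
  · rintro ⟨h1, h2⟩
    exact ⟨l.toFinset, fun x hx => h2 x (by simpa using hx), (List.toFinset_toList h1).symm⟩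

open Classical in
noncomputable def AvF (S : Finset ℕ) : Finset (List ℕ) := (LL S).filter fun l => Lst S l ∧ LAv l

theorem mem_AvF {S : Finset ℕ} {l : List ℕ} : l ∈ AvF S ↔ Lst S l ∧ LAv l := by
  simp only [AvF, mem_filter, mem_LL]
  constructor
  · exact fun h => h.2
  · exact fun h => ⟨⟨h.1.1, fun x hx => (h.1.2 x).1 hx⟩, h⟩

open Classical in
noncomputable def GF (S : Finset ℕ) : Finset (List ℕ × List ℕ) :=
  (LL S ×ˢ LL S).filter fun p => Lst S (p.1 ++ p.2) ∧ LAv p.1 ∧ p.2.Pairwise (· < ·)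

theorem mem_GF {S : Finset ℕ} {p : List ℕ × List ℕ} :
    p ∈ GF S ↔ Lst S (p.1 ++ p.2) ∧ LAv p.1 ∧ p.2.Pairwise (· < ·) := by
  simp only [GF, mem_filter, mem_LL, mem_product]
  constructor
  · exact fun h => h.2
  · intro h
    refine ⟨⟨⟨(List.nodup_append.1 h.1.1).1, ?_⟩, ⟨(List.nodup_append.1 h.1.1).2.1, ?_⟩⟩, h⟩
    · exact fun x hx => (h.1.2 x).1 (by simp [hx])
    · exact fun x hx => (h.1.2 x).1 (by simp [hx])

open Classical in
noncomputable def HF (S : Finset ℕ) : Finset (List ℕ × ℕ × List ℕ) :=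
  (LL S ×ˢ S ×ˢ LL S).filter fun p => Lst S (p.1 ++ p.2.1 :: p.2.2) ∧ LAv (p.1 ++ [p.2.1]) ∧
    (p.2.1 :: p.2.2).Pairwise (· < ·)

theorem mem_HF {S : Finset ℕ} {p : List ℕ × ℕ × List ℕ} :
    p ∈ HF S ↔ Lst S (p.1 ++ p.2.1 :: p.2.2) ∧ LAv (p.1 ++ [p.2.1]) ∧
    (p.2.1 :: p.2.2).Pairwise (· < ·) := by
  simp only [HF, mem_filter, mem_LL, mem_product]
  constructor
  · exact fun h => h.2
  · intro h
    have h2 := (List.nodup_append.1 h.1.1)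
    refine ⟨⟨⟨h2.1, ?_⟩, ?_, ⟨(List.nodup_cons.1 h2.2.1).2, ?_⟩⟩, h⟩
    · exact fun x hx => (h.1.2 x).1 (by simp [hx])
    · exact (h.1.2 _).1 (by simp)
    · exact fun x hx => (h.1.2 x).1 (by simp [hx])

open Classical in
noncomputable def JF (S : Finset ℕ) : Finset (List ℕ) :=
  (LL S).filter fun l => Lst S l ∧ ∃ l1 l2, l = l1 ++ l2 ∧ LAv l1 ∧ l2.Pairwise (· < ·)

theorem mem_JF {S : Finset ℕ} {l : List ℕ} :
    l ∈ JF S ↔ Lst S l ∧ ∃ l1 l2, l = l1 ++ l2 ∧ LAv l1 ∧ l2.Pairwise (· < ·) := by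
  simp only [JF, mem_filter, mem_LL]
  constructor
  · exact fun h => h.2
  · exact fun h => ⟨⟨h.1.1, fun x hx => (h.1.2 x).1 hx⟩, h⟩

theorem Lst_join {S : Finset ℕ} {v : ℕ} {a b : List ℕ} (hv : v ∈ S)
    (ha : Lst (S.filter (· < v)) a) (hb : Lst (S.filter (v < ·)) b) :
    Lst S (a ++ v :: b) := by
  obtain ⟨ha1, ha2⟩ := ha
  obtain ⟨hb1, hb2⟩ := hb
  simp only [mem_filter] at ha2 hb2
  constructor
  · rw [List.nodup_append]
    refine ⟨ha1, List.nodup_cons.2 ⟨fun h => ?_, hb1⟩, ?_⟩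
    · have := ((hb2 _).1 h).2; omega
    · intro x hx y hy
      have := ((ha2 _).1 hx).2
      rcases List.mem_cons.1 hy with rfl | hy
      · omega
      · have := ((hb2 _).1 hy).2; omega
  · intro x
    simp only [List.mem_append, List.mem_cons, ha2, hb2]
    constructor
    · rintro (h | rfl | h)
      exacts [h.1, hv, h.1]
    · intro h
      rcases lt_trichotomy x v with h1 | h1 | h1
      · exact Or.inl ⟨h, h1⟩
      · exact Or.inr (Or.inl h1)
      · exact Or.inr (Or.inr ⟨h, h1⟩)

theorem Lst.perm {S : Finset ℕ} {a b : List ℕ} (h : Lst S a) (hp : a.Perm b) : Lst S b :=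
  ⟨hp.nodup_iff.1 h.1, fun x => by rw [← hp.mem_iff, h.2]⟩

theorem AvF_rec (S : Finset ℕ) (hS : S.Nonempty) :
    #(AvF S) = ∑ v ∈ S, #(AvF (S.filter (· < v))) * #(AvF (S.filter (v < ·))) := by
  simp only [← card_product]
  rw [← card_sigma]
  symm
  have key : ∀ x ∈ S.sigma (fun v => AvF (S.filter (· < v)) ×ˢ AvF (S.filter (v < ·))),
      x.1 ∈ S ∧ (Lst (S.filter (· < x.1)) x.2.1 ∧ LAv x.2.1) ∧
       (Lst (S.filter (x.1 < ·)) x.2.2 ∧ LAv x.2.2) ∧ (∀ y ∈ x.2.1, y < x.1) ∧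
       (∀ y ∈ x.2.2, x.1 < y) := by
    intro x hx
    simp only [mem_sigma, mem_product, mem_AvF] at hx
    refine ⟨hx.1, hx.2.1, hx.2.2, fun y hy => ?_, fun y hy => ?_⟩
    · simpa using ((mem_filter.1 ((hx.2.1.1.2 y).1 hy)).2)
    · simpa using ((mem_filter.1 ((hx.2.2.1.2 y).1 hy)).2)
  refine Finset.card_bij (fun x _ => x.2.1 ++ x.2.2 ++ [x.1]) ?_ ?_ ?_
  · intro x hx
    obtain ⟨h1, h2, h3, h4, h5⟩ := key x hx
    rw [mem_AvF]
    refine ⟨(Lst_join h1 h2.1 h3.1).perm ?_, LAv_join _ _ _ h4 h5 h2.2 h3.2⟩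
    rw [List.append_assoc]
    exact List.Perm.append_left _ (List.perm_append_singleton _ _).symm
  · rintro ⟨v, a, b⟩ hx ⟨v', a', b'⟩ hy h
    obtain ⟨h1, h2, h3, h4, h5⟩ := key _ hx
    obtain ⟨h1', h2', h3', h4', h5'⟩ := key _ hy
    dsimp only at *
    obtain ⟨h7, h6⟩ := List.append_inj' h (by simp)
    simp only [List.cons.injEq, and_true] at h6
    subst h6
    have e := filter_lt_append a b v h4 h5
    have e' := filter_lt_append a' b' v h4' h5'
    rw [h7] at e
    rw [← e.1, ← e.2, e'.1, e'.2]
  · intro l hl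
    rw [mem_AvF] at hl
    rcases List.eq_nil_or_concat l with rfl | ⟨l', v, rfl⟩
    · obtain ⟨x, hx⟩ := hS
      simpa using (hl.1.2 x).2 hx
    · rw [List.concat_eq_append] at hl
      have hn := List.nodup_append.1 hl.1.1
      have hv : v ∉ l' := fun h => hn.2.2 v h v (by simp) rfl
      obtain ⟨e1, e2, e3⟩ := LAv_split l' v hv hl.2
      have hm : ∀ x, x ∈ S ↔ x ∈ l' ∨ x = v := fun x => by rw [← hl.1.2]; simp
      refine ⟨⟨v, l'.filter (· < v), l'.filter (v < ·)⟩, ?_, ?_⟩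
      · simp only [mem_sigma, mem_product, mem_AvF]
        refine ⟨(hm v).2 (Or.inr rfl), ⟨⟨hn.1.filter _, fun x => ?_⟩, e2⟩, ⟨⟨hn.1.filter _, fun x => ?_⟩, e3⟩⟩
        · simp only [List.mem_filter, mem_filter, hm, decide_eq_true_eq]
          constructor
          · tauto
          · rintro ⟨h | h, h'⟩
            · exact ⟨h, h'⟩
            · omega
        · simp only [List.mem_filter, mem_filter, hm, decide_eq_true_eq]
          constructor
          · tauto
          · rintro ⟨h | h, h'⟩
            · exact ⟨h, h'⟩
            · omega
      · dsimp only
        rw [← e1, List.concat_eq_append]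

theorem HF_rec (S : Finset ℕ) :
    #(HF S) = ∑ v ∈ S, #(AvF (S.filter (· < v))) * #(GF (S.filter (v < ·))) := by
  simp only [← card_product]
  rw [← card_sigma]
  symm
  have key : ∀ x ∈ S.sigma (fun v => AvF (S.filter (· < v)) ×ˢ GF (S.filter (v < ·))),
      x.1 ∈ S ∧ (Lst (S.filter (· < x.1)) x.2.1 ∧ LAv x.2.1) ∧
       (Lst (S.filter (x.1 < ·)) (x.2.2.1 ++ x.2.2.2) ∧ LAv x.2.2.1 ∧ x.2.2.2.Pairwise (· < ·)) ∧
       (∀ y ∈ x.2.1, y < x.1) ∧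
       (∀ y ∈ x.2.2.1, x.1 < y) ∧ (∀ y ∈ x.2.2.2, x.1 < y) := by
    intro x hx
    simp only [mem_sigma, mem_product, mem_AvF, mem_GF] at hx
    refine ⟨hx.1, hx.2.1, hx.2.2, fun y hy => ?_, fun y hy => ?_, fun y hy => ?_⟩
    · simpa using ((mem_filter.1 ((hx.2.1.1.2 y).1 hy)).2)
    · simpa using ((mem_filter.1 ((hx.2.2.1.2 y).1 (by simp [hy]))).2)
    · simpa using ((mem_filter.1 ((hx.2.2.1.2 y).1 (by simp [hy]))).2)
  refine Finset.card_bij (fun x _ => (x.2.1 ++ x.2.2.1, x.1, x.2.2.2)) ?_ ?_ ?_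
  · intro x hx
    obtain ⟨h1, h2, h3, h4, h5, h6⟩ := key x hx
    rw [mem_HF]
    refine ⟨(Lst_join h1 h2.1 h3.1).perm ?_, LAv_join _ _ _ h4 h5 h2.2 h3.2.1,
      List.pairwise_cons.2 ⟨h6, h3.2.2⟩⟩
    dsimp only
    rw [List.append_assoc]
    exact List.Perm.append_left _ List.perm_middle.symm
  · rintro ⟨v, a, b, c⟩ hx ⟨v', a', b', c'⟩ hy h
    obtain ⟨h1, h2, h3, h4, h5, -⟩ := key _ hx
    obtain ⟨h1', h2', h3', h4', h5', -⟩ := key _ hy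
    dsimp only at *
    simp only [Prod.mk.injEq] at h
    obtain ⟨h, rfl, rfl⟩ := h
    have e := filter_lt_append a b v h4 h5
    have e' := filter_lt_append a' b' v h4' h5'
    rw [h] at e
    rw [← e.1, ← e.2, e'.1, e'.2]
  · rintro ⟨l', v, c⟩ hl
    rw [mem_HF] at hl
    dsimp only at hl
    obtain ⟨hl1, hl2, hl3⟩ := hl
    have hn := List.nodup_append.1 hl1.1
    have hv : v ∉ l' := fun h => hn.2.2 v h v (by simp) rfl
    obtain ⟨e1, e2, e3⟩ := LAv_split l' v hv hl2
    have hm : ∀ x, x ∈ S ↔ x ∈ l' ∨ x = v ∨ x ∈ c := fun x => by rw [← hl1.2]; simp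
    rw [List.pairwise_cons] at hl3
    refine ⟨⟨v, l'.filter (· < v), l'.filter (v < ·), c⟩, ?_, ?_⟩
    · simp only [mem_sigma, mem_product, mem_AvF, mem_GF]
      refine ⟨(hm v).2 (Or.inr (Or.inl rfl)), ⟨⟨hn.1.filter _, fun x => ?_⟩, e2⟩,
        ⟨⟨?_, fun x => ?_⟩, e3, hl3.2⟩⟩
      · simp only [List.mem_filter, mem_filter, hm, decide_eq_true_eq]
        constructor
        · tauto
        · rintro ⟨h | h | h, h'⟩
          · exact ⟨h, h'⟩
          · omega
          · have := hl3.1 x h; omega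
      · rw [List.nodup_append]
        refine ⟨hn.1.filter _, (List.nodup_cons.1 hn.2.1).2, fun x hx y hy => ?_⟩
        exact hn.2.2 x (List.mem_filter.1 hx).1 y (by simp [hy])
      · simp only [List.mem_append, List.mem_filter, mem_filter, hm, decide_eq_true_eq]
        constructor
        · rintro (h | h)
          · tauto
          · have := hl3.1 x h; tauto
        · rintro ⟨h | h | h, h'⟩
          · exact Or.inl ⟨h, h'⟩
          · omega
          · exact Or.inr h
    · dsimp only
      rw [← e1]

theorem GF_card (S : Finset ℕ) : #(GF S) = ∑ T ∈ S.powerset, #(AvF T) := by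
  rw [← card_sigma]
  refine Finset.card_bij (fun p _ => ⟨p.1.toFinset, p.1⟩) ?_ ?_ ?_
  · rintro ⟨a, b⟩ h
    rw [mem_GF] at h
    obtain ⟨h1, h2, h3⟩ := h
    dsimp only at *
    simp only [mem_sigma, mem_powerset, mem_AvF]
    refine ⟨fun x hx => (h1.2 x).1 ?_, ⟨(List.nodup_append.1 h1.1).1, by simp⟩, h2⟩
    simp at hx
    simp [hx]
  · rintro ⟨a, b⟩ h ⟨a', b'⟩ h' hh
    rw [mem_GF] at h h'
    obtain ⟨h1, h2, h3⟩ := h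
    obtain ⟨h1', h2', h3'⟩ := h'
    dsimp only at *
    have e : a = a' := by
      have := congrArg (fun x => x.2) hh
      exact this
    subst e
    congr 1
    have hp : (a ++ b).Perm (a ++ b') := by
      rw [List.perm_ext_iff_of_nodup h1.1 h1'.1]
      intro x; rw [h1.2, h1'.2]
    rw [List.perm_append_left_iff] at hp
    exact hp.eq_of_pairwise (fun x y _ _ h1 h2 => absurd h1 (by omega)) h3 h3'
  · rintro ⟨T, a⟩ h
    simp only [mem_sigma, mem_powerset, mem_AvF] at h
    obtain ⟨h1, h2, h3⟩ := h
    have eT : a.toFinset = T := by ext x; simp [h2.2]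
    refine ⟨(a, (S \ T).sort (· ≤ ·)), ?_, ?_⟩
    · rw [mem_GF]
      refine ⟨⟨List.nodup_append.2 ⟨h2.1, Finset.sort_nodup _ _, ?_⟩, fun x => ?_⟩, h3, ?_⟩
      · intro x hx y hy
        rw [h2.2] at hx
        simp at hy
        rintro rfl
        exact hy.2 hx
      · simp [h2.2]
        constructor
        · rintro (h | h)
          exacts [h1 h, h.1]
        · tauto
      · exact (Finset.sortedLT_sort _).pairwise
    · dsimp only
      subst eT
      rfl

theorem GF_euler (S : Finset ℕ) : #(JF S) + #(HF S) = #(GF S) := by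
  classical
  have hsub : (HF S).image (fun p => (p.1 ++ [p.2.1], p.2.2)) ⊆ GF S := by
    intro q hq
    obtain ⟨⟨a, v, b⟩, hp, rfl⟩ := mem_image.1 hq
    rw [mem_HF] at hp
    rw [mem_GF]
    refine ⟨by simpa using hp.1, hp.2.1, (List.pairwise_cons.1 hp.2.2).2⟩
  have hH : #((HF S).image (fun p => (p.1 ++ [p.2.1], p.2.2))) = #(HF S) := by
    apply card_image_of_injective
    rintro ⟨a, v, b⟩ ⟨a', v', b'⟩ h
    simp only [Prod.mk.injEq] at h
    obtain ⟨h, rfl⟩ := h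
    obtain ⟨rfl, h6⟩ := List.append_inj' h (by simp)
    simp only [List.cons.injEq, and_true] at h6
    subst h6
    rfl
  have hJ : #(GF S \ (HF S).image (fun p => (p.1 ++ [p.2.1], p.2.2))) = #(JF S) := by
    -- a longer cut lies in the image
    have key : ∀ a b t b', (a, b) ∈ GF S → (a ++ t, b') ∈ GF S → b = t ++ b' → t ≠ [] →
        (a ++ t, b') ∈ (HF S).image (fun p => (p.1 ++ [p.2.1], p.2.2)) := by
      intro a b t b' h h' hb ht
      rcases List.eq_nil_or_concat t with rfl | ⟨s, v, rfl⟩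
      · exact absurd rfl ht
      · rw [mem_image]
        refine ⟨(a ++ s, v, b'), ?_, by simp⟩
        rw [mem_GF] at h h'
        rw [mem_HF]
        subst hb
        refine ⟨by simpa using h.1, by simpa using h'.2.1, ?_⟩
        have := h.2.2
        rw [List.concat_eq_append, List.append_assoc] at this
        exact (List.pairwise_append.1 this).2.1
    refine Finset.card_bij (fun p _ => p.1 ++ p.2) ?_ ?_ ?_
    · rintro ⟨a, b⟩ h
      rw [mem_sdiff, mem_GF] at h
      rw [mem_JF]
      exact ⟨h.1.1, a, b, rfl, h.1.2⟩
    · rintro ⟨a, b⟩ h ⟨a', b'⟩ h' hh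
      rw [mem_sdiff] at h h'
      dsimp only at hh
      rcases List.append_eq_append_iff.1 hh with ⟨t, h1, h2⟩ | ⟨t, h1, h2⟩
      · by_cases ht : t = []
        · subst ht; simp at h1 h2; simp [h1, h2]
        · subst h1
          exact absurd (key a b t b' h.1 h'.1 h2 ht) h'.2
      · by_cases ht : t = []
        · subst ht; simp at h1 h2; simp [h1, h2]
        · subst h1
          exact absurd (key a' b' t b h'.1 h.1 h2 ht) h.2
    · intro l hl
      rw [mem_JF] at hl
      obtain ⟨h1, h2⟩ := hl
      have hex : ∃ n, ∃ l1 l2, l = l1 ++ l2 ∧ (LAv l1 ∧ l2.Pairwise (· < ·)) ∧ l1.length = n := by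
        obtain ⟨l1, l2, e, h⟩ := h2
        exact ⟨_, l1, l2, e, h, rfl⟩
      obtain ⟨l1, l2, e, h, hlen⟩ := Nat.find_spec hex
      refine ⟨(l1, l2), ?_, e.symm⟩
      rw [mem_sdiff, mem_GF]
      refine ⟨⟨by simpa [← e] using h1, h⟩, fun hh => ?_⟩
      obtain ⟨⟨a, v, b⟩, hp, he⟩ := mem_image.1 hh
      rw [mem_HF] at hp
      simp only [Prod.mk.injEq] at he
      obtain ⟨rfl, rfl⟩ := he
      have := Nat.find_min' hex ⟨a, v :: b, by simpa using e,
        ⟨LAv_append_left _ _ hp.2.1, hp.2.2⟩, rfl⟩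
      simp at hlen
      omega
  rw [← hJ, ← hH, card_sdiff_add_card_eq_card hsub]

theorem sum_rank (S : Finset ℕ) (f : ℕ → ℕ → ℕ) :
    ∑ v ∈ S, f #(S.filter (· < v)) #(S.filter (v < ·)) =
      ∑ i ∈ range #S, f i (#S - 1 - i) := by
  have hlt : ∀ v ∈ S, #(S.filter (· < v)) + #(S.filter (v < ·)) + 1 = #S := by
    intro v hv
    have h1 : #(S.filter (fun x => ¬ x < v)) = #(S.filter (v < ·)) + 1 := by
      have : S.filter (fun x => ¬ x < v) = insert v (S.filter (v < ·)) := by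
        ext x
        simp only [mem_filter, mem_insert]
        constructor
        · rintro ⟨h, h'⟩
          rcases eq_or_ne x v with h1 | h1
          · exact Or.inl h1
          · exact Or.inr ⟨h, by omega⟩
        · rintro (rfl | h)
          · exact ⟨hv, by omega⟩
          · exact ⟨h.1, by omega⟩
      rw [this, card_insert_of_notMem (by simp)]
    have h2 := card_filter_add_card_filter_not (s := S) (fun x => x < v)
    omega
  have hmono : ∀ v ∈ S, ∀ w ∈ S, v < w → #(S.filter (· < v)) < #(S.filter (· < w)) := by
    intro v hv w hw h
    apply card_lt_card
    rw [ssubset_iff_of_subset]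
    · exact ⟨v, by simp [hv, h], by simp⟩
    · intro x; simp only [mem_filter]; rintro ⟨h1, h2⟩; exact ⟨h1, by omega⟩
  have hinj : Set.InjOn (fun v => #(S.filter (· < v))) (S : Set ℕ) := by
    intro v hv w hw h
    dsimp only at h
    rcases lt_trichotomy v w with h1 | h1 | h1
    · have := hmono v hv w hw h1; omega
    · exact h1
    · have := hmono w hw v hv h1; omega
  have himg : S.image (fun v => #(S.filter (· < v))) = range #S := by
    apply eq_of_subset_of_card_le
    · intro i hi
      obtain ⟨v, hv, rfl⟩ := mem_image.1 hi
      have := hlt v hv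
      rw [mem_range]; omega
    · rw [card_image_of_injOn hinj]; simp
  rw [← himg, sum_image hinj]
  apply sum_congr rfl
  intro v hv
  have := hlt v hv
  congr 1
  omega

theorem AvF_card (n : ℕ) : ∀ S : Finset ℕ, #S = n → #(AvF S) = catalan n := by
  induction n using Nat.strong_induction_on with
  | _ n ih =>
    intro S hS
    rcases S.eq_empty_or_nonempty with rfl | hne
    · simp at hS
      subst hS
      rw [catalan_zero, card_eq_one]
      refine ⟨[], ?_⟩
      ext l
      rw [mem_AvF, mem_singleton]
      constructor
      · rintro ⟨h, -⟩
        simpa using h.length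
      · rintro rfl
        simp [Lst, LAv]
    · rw [AvF_rec S hne]
      have hpos := hne.card_pos
      have hl : ∀ v ∈ S, #(S.filter (· < v)) < n := fun v hv => by
        rw [← hS]
        exact card_lt_card (filter_ssubset.2 ⟨v, hv, by simp⟩)
      have hr : ∀ v ∈ S, #(S.filter (v < ·)) < n := fun v hv => by
        rw [← hS]
        exact card_lt_card (filter_ssubset.2 ⟨v, hv, by simp⟩)
      rw [sum_congr rfl (fun v hv => by
        rw [ih _ (hl v hv) _ rfl, ih _ (hr v hv) _ rfl])]
      rw [sum_rank S (fun i j => catalan i * catalan j)]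
      obtain ⟨k, rfl⟩ : ∃ k, n = k + 1 := ⟨n - 1, by omega⟩
      rw [hS, catalan_succ, ← Fin.sum_univ_eq_sum_range
        (fun i => catalan i * catalan (k + 1 - 1 - i))]
      simp

/-- binomial transform of the Catalan numbers -/
def gnum (n : ℕ) : ℕ := ∑ k ∈ range (n + 1), n.choose k * catalan k

theorem GF_card' (S : Finset ℕ) : #(GF S) = gnum #S := by
  rw [GF_card, gnum, sum_congr rfl (fun T _ => AvF_card _ T rfl),
    sum_powerset_apply_card catalan]
  simp

theorem JF_card (S : Finset ℕ) :
    #(JF S) + ∑ i ∈ range #S, catalan i * gnum (#S - 1 - i) = gnum #S := by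
  rw [← GF_card', ← GF_euler, HF_rec, ← sum_rank S (fun i j => catalan i * gnum j)]
  congr 1
  apply sum_congr rfl
  intro v hv
  rw [AvF_card _ (S.filter (· < v)) rfl, GF_card']

noncomputable def cS : PowerSeries ℚ := PowerSeries.mk fun n => (catalan n : ℚ)
noncomputable def gS : PowerSeries ℚ := PowerSeries.mk fun n => (gnum n : ℚ)

theorem cS_eq : cS = 1 + PowerSeries.X * cS ^ 2 := by
  have h := congrArg (PowerSeries.map (Nat.castRingHom ℚ)) PowerSeries.catalanSeries_sq_mul_X_add_one
  have e : PowerSeries.map (Nat.castRingHom ℚ) PowerSeries.catalanSeries = cS := by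
    ext n; simp [cS]
  rw [map_add, map_mul, map_pow, e] at h
  simp only [PowerSeries.map_X, map_one] at h
  linear_combination -h

noncomputable def uS : PowerSeries ℚ := PowerSeries.mk 1

theorem uS_mul : (1 - PowerSeries.X) * uS = 1 := by
  rw [mul_comm]; exact PowerSeries.mk_one_mul_one_sub_eq_one ℚ

theorem gS_eq_subst : gS = cS.subst (PowerSeries.X * uS) * uS := by
  have hs : PowerSeries.HasSubst (PowerSeries.X * uS) :=
    PowerSeries.HasSubst.of_constantCoeff_zero' (by simp)
  ext n
  have hcoef : ∀ i ≤ n, PowerSeries.coeff i (cS.subst (PowerSeries.X * uS)) =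
      PowerSeries.coeff i (∑ k ∈ range (n + 1), (catalan k : ℚ) • (PowerSeries.X * uS) ^ k) := by
    intro i hi
    rw [PowerSeries.coeff_subst' hs, finsum_eq_sum_of_support_subset (s := range (n + 1))]
    · simp [cS]
    · intro k hk
      rw [Function.mem_support] at hk
      by_contra h
      simp at h
      apply hk
      rw [mul_pow, PowerSeries.coeff_X_pow_mul', if_neg (by omega), smul_zero]
  have h1 : PowerSeries.coeff n (cS.subst (PowerSeries.X * uS) * uS) =
      PowerSeries.coeff n
        ((∑ k ∈ range (n + 1), (catalan k : ℚ) • (PowerSeries.X * uS) ^ k) * uS) := by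
    rw [PowerSeries.coeff_mul, PowerSeries.coeff_mul]
    apply sum_congr rfl
    intro p hp
    rw [hcoef _ (by rw [HasAntidiagonal.mem_antidiagonal] at hp; omega)]
  rw [h1, sum_mul, map_sum]
  simp only [gS, PowerSeries.coeff_mk, gnum]
  push_cast
  apply sum_congr rfl
  intro k hk
  rw [mem_range] at hk
  rw [smul_mul_assoc, mul_pow, mul_assoc, ← pow_succ, PowerSeries.coeff_smul,
    PowerSeries.coeff_X_pow_mul', if_pos (by omega), uS,
    PowerSeries.mk_one_pow_eq_mk_choose_add, PowerSeries.coeff_mk,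
    show k + (n - k) = n by omega, smul_eq_mul, mul_comm]

noncomputable def dS : PowerSeries ℚ := (1 - PowerSeries.X) * gS

theorem dS_eq : (1 - PowerSeries.X) * dS = (1 - PowerSeries.X) + PowerSeries.X * dS ^ 2 := by
  have hs : PowerSeries.HasSubst (PowerSeries.X * uS) :=
    PowerSeries.HasSubst.of_constantCoeff_zero' (by simp)
  have hd : dS = cS.subst (PowerSeries.X * uS) := by
    rw [dS, gS_eq_subst]
    linear_combination (cS.subst (PowerSeries.X * uS)) * uS_mul
  have h := congrArg (PowerSeries.substAlgHom (R := ℚ) hs) cS_eq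
  rw [map_add, map_mul, map_pow, map_one] at h
  simp only [PowerSeries.coe_substAlgHom, PowerSeries.subst_X hs, ← hd] at h
  linear_combination (1 - PowerSeries.X) * h + PowerSeries.X * dS ^ 2 * uS_mul

theorem final (F : PowerSeries ℚ) (hF : F + PowerSeries.X * (cS * gS) = gS) :
    ∃ c d b m : PowerSeries ℚ,
    c = 1 + PowerSeries.X * c ^ 2 ∧
    (1 - PowerSeries.X) * d = (1 - PowerSeries.X) + PowerSeries.X * d ^ 2 ∧
    (1 - PowerSeries.X) * b
      = (1 - PowerSeries.X) * PowerSeries.X * c * b + PowerSeries.X ^ 2 ∧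
    (1 - PowerSeries.X) * m
      = PowerSeries.X ^ 2 * (d - 1)
        + (1 - PowerSeries.X) * PowerSeries.X * c * b * (d - 1)
        + (1 - PowerSeries.X) * PowerSeries.X * c * m * d ∧
    F = c + c * m * d := by
  have hc := cS_eq
  have hd := dS_eq
  have hu := uS_mul
  have hg : gS = uS * dS := by rw [dS]; linear_combination (-gS) * hu
  -- inverse of `1 - X c d`
  obtain ⟨w, hw⟩ : ∃ w, (1 - PowerSeries.X * cS * dS) * w = 1 := by
    refine ⟨(1 - PowerSeries.X * cS * dS)⁻¹, PowerSeries.mul_inv_cancel _ (by simp)⟩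
  rw [hg] at hF
  generalize cS = c at *
  generalize dS = d at *
  generalize uS = u at *
  generalize (PowerSeries.X : PowerSeries ℚ) = z at *
  have hcu : (1 - z * c) * c = 1 := by linear_combination hc
  refine ⟨c, d, z ^ 2 * c * u, (d - 1) * z ^ 2 * c * u * w, hc, hd, ?_, ?_, ?_⟩
  · linear_combination (z ^ 2 * u * (1 - z)) * hcu + z ^ 2 * hu
  · linear_combination (d - 1) * z ^ 2 * c * (1 - z) * u * hw
      + (d - 1) * z ^ 2 * ((1 - z) * u * hc + hu)
  · have hp : (1 - z) * c ^ 2 * (1 - z * c * d) + c ^ 3 * d * (d - 1) * z ^ 2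
        = d * (1 - z * c * d) := by
      linear_combination (-(z * c ^ 3 + c)) * hd + ((1 - z) * c + d * z * c + d) * hc
    linear_combination hF - u * w * (1 - z * c) * hp
      + c * (((1 - z) * u) * ((1 - z * c * d) * w) * hcu + (1 - z * c * d) * w * hu + hw)
      + c ^ 2 * d * (d - 1) * z ^ 2 * u * w * hcu - u * d * (1 - z * c) * hw

theorem LAv_iff (l : List ℕ) : LAv l ↔ ∀ (i j k : ℕ) (hij : i < j) (hjk : j < k)
    (hk : k < l.length), ¬ (l[j] < l[k] ∧ l[k] < l[i]) := by
  induction l with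
  | nil => simp [LAv]
  | cons a l ih =>
    rw [LAv, ih, List.pairwise_iff_getElem]
    constructor
    · rintro ⟨h1, h2⟩ i j k hij hjk hk
      obtain ⟨j, rfl⟩ : ∃ j', j = j' + 1 := ⟨j - 1, by omega⟩
      obtain ⟨k, rfl⟩ : ∃ j', k = j' + 1 := ⟨k - 1, by omega⟩
      simp only [List.length_cons] at hk
      cases i with
      | zero => simpa using h1 j k (by omega) (by omega) (by omega)
      | succ i => simpa using h2 i j k (by omega) (by omega) (by omega)
    · intro h
      refine ⟨fun j k hj hk hjk => ?_, fun i j k hij hjk hk => ?_⟩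
      · exact h 0 (j + 1) (k + 1) (by omega) (by omega) (by simpa using hk)
      · exact h (i + 1) (j + 1) (k + 1) (by omega) (by omega) (by simpa using hk)

/-- one-line notation of a permutation -/
def lof {n : ℕ} (σ : Equiv.Perm (Fin n)) : List ℕ := List.ofFn fun i => (σ i : ℕ)

theorem lof_length {n : ℕ} (σ : Equiv.Perm (Fin n)) : (lof σ).length = n := by simp [lof]

theorem lof_get {n : ℕ} (σ : Equiv.Perm (Fin n)) (i : ℕ) (h : i < (lof σ).length) :
    (lof σ)[i] = (σ ⟨i, by rwa [lof_length] at h⟩ : ℕ) := by simp [lof]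

theorem contains312 {n : ℕ} (σ : Equiv.Perm (Fin n)) (k : ℕ) :
    ¬ ContainsIn σ p312 {i : Fin n | (i : ℕ) < k} ↔ LAv ((lof σ).take k) := by
  rw [LAv_iff]
  constructor
  · rintro h i j l hij hjl hl ⟨h1, h2⟩
    simp only [List.getElem_take, lof_get, List.length_take, lof_length, lt_min_iff] at h1 h2 hl
    apply h
    refine ⟨![⟨i, by omega⟩, ⟨j, by omega⟩, ⟨l, by omega⟩], ?_, ?_, ?_⟩
    · intro s t hst
      fin_cases s <;> fin_cases t <;> simp_all <;> omega
    · intro s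
      fin_cases s <;> simp <;> omega
    · intro s t
      rw [Fin.lt_def]
      fin_cases s <;> fin_cases t <;> simp [p312] <;> omega
  · rintro h ⟨f, hf, hfS, hp⟩
    have h01 : f 0 < f 1 := hf (by decide)
    have h12 : f 1 < f 2 := hf (by decide)
    have a1 := (hp 1 2).2 (by simp [p312])
    have a2 := (hp 2 0).2 (by simp [p312])
    refine h (f 0) (f 1) (f 2) h01 h12 ?_ ?_
    · simp only [List.length_take, lof_length, lt_min_iff]
      exact ⟨hfS 2, (f 2).2⟩
    · simp only [List.getElem_take, lof_get]
      exact ⟨a1, a2⟩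

theorem contains21 {n : ℕ} (σ : Equiv.Perm (Fin n)) (k : ℕ) :
    ¬ ContainsIn σ p21 {i : Fin n | k ≤ (i : ℕ)} ↔ ((lof σ).drop k).Pairwise (· < ·) := by
  rw [List.pairwise_iff_getElem]
  constructor
  · intro h i j hi hj hij
    simp only [List.getElem_drop, lof_get, List.length_drop, lof_length] at hi hj ⊢
    by_contra hlt
    apply h
    have hne : σ ⟨k + i, by omega⟩ ≠ σ ⟨k + j, by omega⟩ := by
      intro h; simp at h; omega
    rw [Ne, Fin.ext_iff] at hne
    refine ⟨![⟨k + i, by omega⟩, ⟨k + j, by omega⟩], ?_, ?_, ?_⟩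
    · intro s t hst
      fin_cases s <;> fin_cases t <;> simp_all
    · intro s
      fin_cases s <;> simp
    · intro s t
      rw [Fin.lt_def]
      fin_cases s <;> fin_cases t <;> simp [p21] <;> omega
  · rintro h ⟨f, hf, hfS, hp⟩
    have h01 : f 0 < f 1 := hf (by decide)
    have a1 := (hp 1 0).2 (by simp [p21])
    have b0 : k ≤ (f 0 : ℕ) := hfS 0
    have b1 : k ≤ (f 1 : ℕ) := hfS 1
    have := h (f 0 - k) (f 1 - k) (by simp [lof_length]; omega) (by simp [lof_length]; omega)
      (by omega)
    simp only [List.getElem_drop, lof_get] at this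
    have e0 : (⟨k + (f 0 - k), by omega⟩ : Fin n) = f 0 := by ext; simp; omega
    have e1 : (⟨k + (f 1 - k), by omega⟩ : Fin n) = f 1 := by ext; simp; omega
    rw [e0, e1] at this
    rw [Fin.lt_def] at a1
    omega

theorem juxt_iff {n : ℕ} (σ : Equiv.Perm (Fin n)) : JuxtAv p312 p21 σ ↔
    ∃ l1 l2, lof σ = l1 ++ l2 ∧ LAv l1 ∧ l2.Pairwise (· < ·) := by
  simp only [JuxtAv, contains312, contains21]
  constructor
  · rintro ⟨k, -, h1, h2⟩
    exact ⟨_, _, (List.take_append_drop k _).symm, h1, h2⟩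
  · rintro ⟨l1, l2, e, h1, h2⟩
    refine ⟨l1.length, ?_, ?_, ?_⟩
    · rw [← lof_length σ, e]; simp
    · rw [e]; simpa using h1
    · rw [e]; simpa using h2

theorem lof_Lst {n : ℕ} (σ : Equiv.Perm (Fin n)) : Lst (range n) (lof σ) := by
  constructor
  · rw [lof, List.nodup_ofFn]
    intro i j h
    exact σ.injective (Fin.ext h)
  · intro x
    simp only [lof, List.mem_ofFn, mem_range]
    constructor
    · rintro ⟨i, rfl⟩; exact (σ i).2
    · intro hx
      exact ⟨σ.symm ⟨x, hx⟩, by simp⟩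

theorem lof_inj {n : ℕ} : Function.Injective (lof (n := n)) := by
  intro σ τ h
  have := List.ofFn_injective h
  ext i
  exact congrFun this i

theorem lof_surj {n : ℕ} (l : List ℕ) (h : Lst (range n) l) : ∃ σ : Equiv.Perm (Fin n), lof σ = l := by
  have hl : l.length = n := by rw [h.length]; simp
  have hlt : ∀ i (hi : i < l.length), l[i] < n := fun i hi => by
    have := (h.2 l[i]).1 (List.getElem_mem hi)
    simpa using this
  let f : Fin n → Fin n := fun i => ⟨l[(i : ℕ)], hlt _ _⟩
  have hf : Function.Injective f := by
    intro i j hij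
    simp only [f, Fin.mk.injEq] at hij
    ext
    exact (h.1.getElem_inj_iff).1 hij
  refine ⟨Equiv.ofBijective f (Finite.injective_iff_bijective.1 hf), ?_⟩
  apply List.ext_getElem
  · rw [lof_length, hl]
  · intro i h1 h2
    rw [lof_get]
    simp [f]

theorem card_juxt (n : ℕ) :
    Nat.card {σ : Equiv.Perm (Fin n) // JuxtAv p312 p21 σ} = #(JF (range n)) := by
  have e : Nat.card (JF (range n)) = #(JF (range n)) := by simp
  rw [← e]
  refine Nat.card_eq_of_bijective (fun σ => ⟨lof σ.1, ?_⟩) ⟨?_, ?_⟩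
  · rw [mem_JF]
    exact ⟨lof_Lst _, (juxt_iff _).1 σ.2⟩
  · intro σ τ h
    simp only [Subtype.mk.injEq] at h
    exact Subtype.ext (lof_inj h)
  · rintro ⟨l, hl⟩
    rw [mem_JF] at hl
    obtain ⟨σ, rfl⟩ := lof_surj l hl.1
    exact ⟨⟨σ, (juxt_iff σ).2 hl.2⟩, rfl⟩

theorem F_eq : F + PowerSeries.X * (cS * gS) = gS := by
  ext n
  have h := JF_card (range n)
  rw [card_range] at h
  have hF : PowerSeries.coeff n F = (#(JF (range n)) : ℚ) := by
    rw [F, PowerSeries.coeff_mk, card_juxt]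
  have hG : PowerSeries.coeff n gS = (gnum n : ℚ) := by
    rw [gS, PowerSeries.coeff_mk]
  rw [map_add, hF, hG, ← h]
  push_cast
  congr 1
  cases n with
  | zero => simp
  | succ n =>
    rw [PowerSeries.coeff_succ_X_mul, PowerSeries.coeff_mul,
      Finset.Nat.sum_antidiagonal_eq_sum_range_succ
        (fun i j => PowerSeries.coeff i cS * PowerSeries.coeff j gS)]
    simp [cS, gS]

theorem stmt : ∃ c d b m : PowerSeries ℚ,
    c = 1 + PowerSeries.X * c ^ 2 ∧
    (1 - PowerSeries.X) * d = (1 - PowerSeries.X) + PowerSeries.X * d ^ 2 ∧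
    (1 - PowerSeries.X) * b
      = (1 - PowerSeries.X) * PowerSeries.X * c * b + PowerSeries.X ^ 2 ∧
    (1 - PowerSeries.X) * m
      = PowerSeries.X ^ 2 * (d - 1)
        + (1 - PowerSeries.X) * PowerSeries.X * c * b * (d - 1)
        + (1 - PowerSeries.X) * PowerSeries.X * c * m * d ∧
    F = c + c * m * d := by
  exact final F F_eq
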